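/- Invariance of the admissible set under the discrete-in-time 1-2 junction scheme: if the time step satisfies Δt < 1/(1 + 2η_0) and f^{1,n}, f^{2,n}, f^{3,n} ∈ B, then the explicit Euler updates satisfy f^{1,n+1}, f^{2,n+1}, f^{3,n+1} ∈ B; consequently, for initial data in B and boundary data f̄^{1,n} ∈ B, Φ̄^{2,n}, Φ̄^{3,n} ∈ [0,1] at every step, all iterates of the scheme remain in B for all n ≥ 0. -/

import Mathlib

open Set

noncomputable def rhoF {n : ℕ} (f : Fin n → ℝ) : ℝ := ∑ j, f j

noncomputable def fluxF {n : ℕ} (v f : Fin n → ℝ) : ℝ := ∑ j, v j * f j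

noncomputable def gainF {n : ℕ} (η0 : ℝ) (A : Fin n → Fin n → Fin n → ℝ → ℝ)
    (j : Fin n) (f : Fin n → ℝ) : ℝ :=
  η0 * rhoF f * ∑ h, ∑ k, A h k j (rhoF f) * f h * f k

noncomputable def lossF {n : ℕ} (η0 : ℝ) (f : Fin n → ℝ) : ℝ := η0 * (rhoF f) ^ 2

def admissibleF {n : ℕ} (f : Fin n → ℝ) : Prop :=
  (∀ j, 0 ≤ f j ∧ f j ≤ 1) ∧ rhoF f ≤ 1

noncomputable def deltaC {n : ℕ} (j : Fin n) : ℝ := if (j : ℕ) = 0 then 0 else 1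

def IsSpeedLattice {n : ℕ} (hn : 2 ≤ n) (v : Fin n → ℝ) : Prop :=
  StrictMono v ∧ v ⟨0, by omega⟩ = 0 ∧ v ⟨n - 1, by omega⟩ = 1

def IsFluxLimiterW (Φ : ℝ → ℝ → ℝ) : Prop :=
  (∀ u ∈ Icc (0:ℝ) 1, ∀ w ∈ Icc (0:ℝ) 1, Φ u w ∈ Icc (0:ℝ) 1) ∧
  (∀ u ∈ Icc (0:ℝ) 1, ∀ w ∈ Icc (0:ℝ) 1, 1 < u + w → Φ u w * u ≤ 1 - w)

def IsTableOfGamesW {n : ℕ} (A : Fin n → Fin n → Fin n → ℝ → ℝ) : Prop :=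
  (∀ h k j : Fin n, ∀ u ∈ Icc (0:ℝ) 1, A h k j u ∈ Icc (0:ℝ) 1) ∧
  (∀ h k : Fin n, ∀ u ∈ Icc (0:ℝ) 1, ∑ j, A h k j u = 1)

noncomputable def euler1 {n : ℕ} (v : Fin n → ℝ) (η0 : ℝ) (A : Fin n → Fin n → Fin n → ℝ → ℝ)
    (Φ : ℝ → ℝ → ℝ) (a Δt : ℝ) (fbar1 f1 f2 f3 : Fin n → ℝ) (j : Fin n) : ℝ :=
  f1 j - Δt * v j * ((a * Φ (a * ∑ k, deltaC k * f1 k) (rhoF f2)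
      + (1 - a) * Φ ((1 - a) * ∑ k, deltaC k * f1 k) (rhoF f3)) * f1 j
    - Φ (∑ k, fbar1 k) (rhoF f1) * fbar1 j)
  + Δt * (gainF η0 A j f1 - f1 j * lossF η0 f1)

noncomputable def euler2 {n : ℕ} (v : Fin n → ℝ) (η0 : ℝ) (A : Fin n → Fin n → Fin n → ℝ → ℝ)
    (Φ : ℝ → ℝ → ℝ) (a Δt : ℝ) (Φbar2 : ℝ) (f1 f2 : Fin n → ℝ) (j : Fin n) : ℝ :=
  f2 j - Δt * v j * (Φbar2 * f2 j
    - a * Φ (a * ∑ k, deltaC k * f1 k) (rhoF f2) * f1 j * deltaC j)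
  + Δt * (gainF η0 A j f2 - f2 j * lossF η0 f2)

noncomputable def euler3 {n : ℕ} (v : Fin n → ℝ) (η0 : ℝ) (A : Fin n → Fin n → Fin n → ℝ → ℝ)
    (Φ : ℝ → ℝ → ℝ) (a Δt : ℝ) (Φbar3 : ℝ) (f1 f3 : Fin n → ℝ) (j : Fin n) : ℝ :=
  f3 j - Δt * v j * (Φbar3 * f3 j
    - (1 - a) * Φ ((1 - a) * ∑ k, deltaC k * f1 k) (rhoF f3) * f1 j * deltaC j)
  + Δt * (gainF η0 A j f3 - f3 j * lossF η0 f3)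

theorem IsSpeedLattice.mem_Icc {n : ℕ} {hn : 2 ≤ n} {v : Fin n → ℝ} (hv : IsSpeedLattice hn v)
    (j : Fin n) : v j ∈ Icc (0:ℝ) 1 := by
  obtain ⟨hmono, hfirst, hlast⟩ := hv
  constructor
  · rw [← hfirst]
    exact hmono.monotone (Fin.mk_le_of_le_val (Nat.zero_le _))
  · rw [← hlast]
    exact hmono.monotone (Fin.le_def.2 (Nat.le_sub_one_of_lt j.isLt))

theorem admissibleF.rhoF_mem_Icc {n : ℕ} {f : Fin n → ℝ} (hf : admissibleF f) :
    rhoF f ∈ Icc (0:ℝ) 1 :=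
  ⟨Finset.sum_nonneg fun j _ => (hf.1 j).1, hf.2⟩

theorem admissibleF_of_nonneg {n : ℕ} {f : Fin n → ℝ} (h0 : ∀ j, 0 ≤ f j) (h1 : rhoF f ≤ 1) :
    admissibleF f :=
  ⟨fun j => ⟨h0 j,
    (Finset.single_le_sum (fun i _ => h0 i) (Finset.mem_univ j)).trans h1⟩, h1⟩

theorem deltaC_mem_Icc {n : ℕ} (j : Fin n) : deltaC j ∈ Icc (0:ℝ) 1 := by
  unfold deltaC
  split_ifs <;> simp

theorem sum_deltaC_mul_mem_Icc {n : ℕ} {f : Fin n → ℝ} (hf : admissibleF f) :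
    ∑ k, deltaC k * f k ∈ Icc (0:ℝ) 1 :=
  ⟨Finset.sum_nonneg fun j _ => mul_nonneg (deltaC_mem_Icc j).1 (hf.1 j).1,
    (Finset.sum_le_sum fun j _ =>
      mul_le_of_le_one_left (hf.1 j).1 (deltaC_mem_Icc j).2).trans hf.2⟩

theorem gainF_nonneg {n : ℕ} {η0 : ℝ} (hη0 : 0 ≤ η0)
    {A : Fin n → Fin n → Fin n → ℝ → ℝ} (hA : IsTableOfGamesW A)
    {f : Fin n → ℝ} (hf : admissibleF f) (j : Fin n) : 0 ≤ gainF η0 A j f := by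
  have hρ := hf.rhoF_mem_Icc
  refine mul_nonneg (mul_nonneg hη0 hρ.1) (Finset.sum_nonneg fun h _ =>
    Finset.sum_nonneg fun k _ => mul_nonneg (mul_nonneg (hA.1 h k j _ hρ).1 ?_) ?_)
  exacts [(hf.1 h).1, (hf.1 k).1]

theorem sum_gainF {n : ℕ} (η0 : ℝ) {A : Fin n → Fin n → Fin n → ℝ → ℝ}
    (hA : IsTableOfGamesW A) {f : Fin n → ℝ} (hf : admissibleF f) :
    ∑ j, gainF η0 A j f = rhoF f * lossF η0 f := by
  have hsum : ∑ j, ∑ h, ∑ k, A h k j (rhoF f) * f h * f k = rhoF f * rhoF f := by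
    rw [Finset.sum_comm]
    simp_rw [rhoF, Finset.sum_mul_sum]
    refine Finset.sum_congr rfl fun h _ => ?_
    rw [Finset.sum_comm]
    refine Finset.sum_congr rfl fun k _ => ?_
    rw [← Finset.sum_mul, ← Finset.sum_mul]
    have := hA.2 h k _ hf.rhoF_mem_Icc
    rw [rhoF] at this
    rw [this, one_mul]
  simp only [gainF, lossF]
  rw [← Finset.mul_sum, hsum]
  ring

theorem IsFluxLimiterW.add_mul_le_one {Φ : ℝ → ℝ → ℝ} (hΦ : IsFluxLimiterW Φ) {u w t : ℝ}
    (hu : u ∈ Icc (0:ℝ) 1) (hw : w ∈ Icc (0:ℝ) 1) (ht : t ∈ Icc (0:ℝ) 1) :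
    w + t * (Φ u w * u) ≤ 1 := by
  have hφ := hΦ.1 u hu w hw
  have hle : t * (Φ u w * u) ≤ Φ u w * u :=
    mul_le_of_le_one_left (mul_nonneg hφ.1 hu.1) ht.2
  by_cases h : 1 < u + w
  · linarith [hΦ.2 u hu w hw h]
  · linarith [mul_le_of_le_one_left hu.1 hφ.2]

/-- One explicit Euler step on a single road with outflow coefficient `c` and incoming state `q`
preserves admissibility. -/
theorem admissibleF_euler_step {n : ℕ} {v : Fin n → ℝ} (hv : ∀ j, v j ∈ Icc (0:ℝ) 1)
    {η0 : ℝ} (hη0 : 0 < η0)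
    {A : Fin n → Fin n → Fin n → ℝ → ℝ} (hA : IsTableOfGamesW A)
    {Φ : ℝ → ℝ → ℝ} (hΦ : IsFluxLimiterW Φ)
    {Δt : ℝ} (hΔt0 : 0 < Δt) (hΔt : Δt < 1 / (1 + 2 * η0))
    {f q g : Fin n → ℝ} (hf : admissibleF f) (hq : ∀ j, 0 ≤ q j) (hq1 : ∑ j, q j ≤ 1)
    {c : ℝ} (hc : c ∈ Icc (0:ℝ) 1)
    (hg : ∀ j, g j = f j - Δt * v j * (c * f j - Φ (∑ k, q k) (rhoF f) * q j)
      + Δt * (gainF η0 A j f - f j * lossF η0 f)) :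
    admissibleF g := by
  have hρ := hf.rhoF_mem_Icc
  have hu : ∑ j, q j ∈ Icc (0:ℝ) 1 := ⟨Finset.sum_nonneg fun j _ => hq j, hq1⟩
  have hφ := hΦ.1 _ hu _ hρ
  rw [lt_div_iff₀ (by positivity)] at hΔt
  have hΔtη : 0 < Δt * η0 := mul_pos hΔt0 hη0
  refine admissibleF_of_nonneg (fun j => ?_) ?_
  · have hloss : lossF η0 f ≤ η0 :=
      mul_le_of_le_one_right hη0.le (pow_le_one₀ hρ.1 hρ.2)
    have hvc : v j * c ≤ 1 := mul_le_one₀ (hv j).2 hc.1 hc.2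
    have hrate : 0 ≤ 1 - Δt * (v j * c + lossF η0 f) := by
      have := mul_le_mul_of_nonneg_left (add_le_add hvc hloss) hΔt0.le
      linarith
    have hrest := mul_nonneg (hf.1 j).1 hrate
    have hin := mul_nonneg (mul_nonneg hΔt0.le (hv j).1) (mul_nonneg hφ.1 (hq j))
    have hgain := mul_nonneg hΔt0.le (gainF_nonneg hη0.le hA hf j)
    rw [hg]
    linarith
  · have hle : ∀ j, g j ≤ f j + Δt * Φ (∑ k, q k) (rhoF f) * q j
        + Δt * (gainF η0 A j f - f j * lossF η0 f) := fun j => by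
      have hout := mul_nonneg (mul_nonneg hΔt0.le (hv j).1) (mul_nonneg hc.1 (hf.1 j).1)
      have hin := mul_le_of_le_one_left
        (mul_nonneg hΔt0.le (mul_nonneg hφ.1 (hq j))) (hv j).2
      rw [hg]
      linarith
    calc rhoF g ≤ ∑ j, (f j + Δt * Φ (∑ k, q k) (rhoF f) * q j
          + Δt * (gainF η0 A j f - f j * lossF η0 f)) := Finset.sum_le_sum fun j _ => hle j
      _ = rhoF f + Δt * (Φ (∑ k, q k) (rhoF f) * ∑ k, q k) := by
        rw [Finset.sum_add_distrib, Finset.sum_add_distrib, ← Finset.mul_sum, ← Finset.mul_sum,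
          Finset.sum_sub_distrib, ← Finset.sum_mul, sum_gainF η0 hA hf]
        simp only [rhoF]
        ring
      _ ≤ 1 := hΦ.add_mul_le_one hu hρ ⟨hΔt0.le, by linarith⟩

/-- One explicit Euler step on an outgoing road that receives the fraction `b` of the moving
part of the incoming road's state `e` preserves admissibility. -/
theorem admissibleF_outgoing_euler_step {n : ℕ} {v : Fin n → ℝ} (hv : ∀ j, v j ∈ Icc (0:ℝ) 1)
    {η0 : ℝ} (hη0 : 0 < η0)
    {A : Fin n → Fin n → Fin n → ℝ → ℝ} (hA : IsTableOfGamesW A)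
    {Φ : ℝ → ℝ → ℝ} (hΦ : IsFluxLimiterW Φ)
    {b : ℝ} (hb : b ∈ Icc (0:ℝ) 1)
    {Δt : ℝ} (hΔt0 : 0 < Δt) (hΔt : Δt < 1 / (1 + 2 * η0))
    {e f g : Fin n → ℝ} (he : admissibleF e) (hf : admissibleF f)
    {c : ℝ} (hc : c ∈ Icc (0:ℝ) 1)
    (hg : ∀ j, g j = euler2 v η0 A Φ b Δt c e f j) :
    admissibleF g := by
  have hsum : ∑ j, b * (deltaC j * e j) = b * ∑ k, deltaC k * e k := (Finset.mul_sum ..).symm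
  have hmem := sum_deltaC_mul_mem_Icc he
  refine admissibleF_euler_step (q := fun j => b * (deltaC j * e j)) hv hη0 hA hΦ hΔt0 hΔt hf
    (fun j => mul_nonneg hb.1 (mul_nonneg (deltaC_mem_Icc j).1 (he.1 j).1)) ?_ hc fun j => ?_
  · rw [hsum]
    exact mul_le_one₀ hb.2 hmem.1 hmem.2
  · rw [hg, hsum, euler2]
    ring

/-- Invariance of the admissible set under the discrete-in-time 1-2 junction scheme:
for initial data in `B` and admissible boundary data at every step, if
`Δt < 1/(1+2η0)` then all iterates of the explicit Euler scheme remain in `B`. -/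
theorem euler_scheme_invariance
    {n : ℕ} (hn : 2 ≤ n) (v : Fin n → ℝ) (hv : IsSpeedLattice hn v)
    (η0 : ℝ) (hη0 : 0 < η0)
    (A : Fin n → Fin n → Fin n → ℝ → ℝ) (hA : IsTableOfGamesW A)
    (Φ : ℝ → ℝ → ℝ) (hΦ : IsFluxLimiterW Φ)
    (a : ℝ) (ha : a ∈ Icc (0:ℝ) 1)
    (Δt : ℝ) (hΔt0 : 0 < Δt) (hΔt : Δt < 1 / (1 + 2 * η0))
    (f1 f2 f3 fbar1 : ℕ → Fin n → ℝ) (Φbar2 Φbar3 : ℕ → ℝ)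
    (hfbar1 : ∀ m, admissibleF (fbar1 m))
    (hΦbar2 : ∀ m, Φbar2 m ∈ Icc (0:ℝ) 1) (hΦbar3 : ∀ m, Φbar3 m ∈ Icc (0:ℝ) 1)
    (hinit : admissibleF (f1 0) ∧ admissibleF (f2 0) ∧ admissibleF (f3 0))
    (hstep1 : ∀ m, ∀ j : Fin n,
      f1 (m + 1) j = euler1 v η0 A Φ a Δt (fbar1 m) (f1 m) (f2 m) (f3 m) j)
    (hstep2 : ∀ m, ∀ j : Fin n,
      f2 (m + 1) j = euler2 v η0 A Φ a Δt (Φbar2 m) (f1 m) (f2 m) j)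
    (hstep3 : ∀ m, ∀ j : Fin n,
      f3 (m + 1) j = euler3 v η0 A Φ a Δt (Φbar3 m) (f1 m) (f3 m) j) :
    ∀ m, admissibleF (f1 m) ∧ admissibleF (f2 m) ∧ admissibleF (f3 m) := by
  have hv' := hv.mem_Icc
  have ha' : 1 - a ∈ Icc (0:ℝ) 1 := ⟨by linarith [ha.2], by linarith [ha.1]⟩
  intro m
  induction m with
  | zero => exact hinit
  | succ m ih =>
    obtain ⟨h1, h2, h3⟩ := ih
    have hδ := sum_deltaC_mul_mem_Icc h1
    have hΦ2 := hΦ.1 (a * ∑ k, deltaC k * f1 m k)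
      ⟨mul_nonneg ha.1 hδ.1, mul_le_one₀ ha.2 hδ.1 hδ.2⟩ _ h2.rhoF_mem_Icc
    have hΦ3 := hΦ.1 ((1 - a) * ∑ k, deltaC k * f1 m k)
      ⟨mul_nonneg ha'.1 hδ.1, mul_le_one₀ ha'.2 hδ.1 hδ.2⟩ _ h3.rhoF_mem_Icc
    exact ⟨admissibleF_euler_step hv' hη0 hA hΦ hΔt0 hΔt h1 (fun j => ((hfbar1 m).1 j).1)
        (hfbar1 m).2 (convex_Icc (0:ℝ) 1 hΦ2 hΦ3 ha.1 ha'.1 (by ring)) (hstep1 m),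
      admissibleF_outgoing_euler_step hv' hη0 hA hΦ ha hΔt0 hΔt h1 h2 (hΦbar2 m) (hstep2 m),
      admissibleF_outgoing_euler_step hv' hη0 hA hΦ ha' hΔt0 hΔt h1 h3 (hΦbar3 m) (hstep3 m)⟩
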